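/- For 1 < p < ∞, the Haar system is an unconditional basic sequence in L_p[0,1]: there is a constant H_p such that for every finitely supported family of coefficients {a_{n,i}} and every family of signs {ε_{n,i}} ∈ {±1}, ‖∑ a_{n,i} h_{n,i}‖_p ≤ H_p ‖∑ ε_{n,i} a_{n,i} h_{n,i}‖_p. -/

import Mathlib

open MeasureTheory Finset

/-- The Haar function `h_{n,i}` for `n ≥ 0`, `1 ≤ i ≤ 2^n`. -/
noncomputable def haarFn (n i : ℕ) (t : ℝ) : ℝ :=
  if t ∈ Set.Ioo ((2 * (i : ℝ) - 2) / 2 ^ (n + 1)) ((2 * (i : ℝ) - 1) / 2 ^ (n + 1)) then 1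
  else if t ∈ Set.Ioo ((2 * (i : ℝ) - 1) / 2 ^ (n + 1)) ((2 * (i : ℝ)) / 2 ^ (n + 1)) then -1
  else 0

/-- The Haar system, indexed by pairs `(n,i)`; the index `(0,0)` corresponds to the
constant function `h_{0,0} ≡ 1`, and `(n,i)` with `1 ≤ i ≤ 2^n` to `h_{n,i}`. -/
noncomputable def haarSystem (q : ℕ × ℕ) : ℝ → ℝ :=
  if q = (0, 0) then fun _ => 1 else haarFn q.1 q.2

/-- An auxiliary one-variable profile, the building block of `burkholderFn` along diagonals. -/
noncomputable def burkholderProfile (p A β d t : ℝ) : ℝ :=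
  -A * t ^ p + β * d * t ^ (p - 1) - β * d ^ (p - 1) * t

section Profile

variable {p A β d : ℝ}

lemma hasDerivAt_burkholderProfile {t : ℝ} (ht : 0 < t) :
    HasDerivAt (burkholderProfile p A β d)
      (-A * (p * t ^ (p - 1)) + β * d * ((p - 1) * t ^ (p - 2)) - β * d ^ (p - 1)) t := by
  have h1 := (Real.hasDerivAt_rpow_const (x := t) (p := p) (Or.inl ht.ne')).const_mul (-A)
  have h2 := (Real.hasDerivAt_rpow_const (x := t) (p := p - 1) (Or.inl ht.ne')).const_mul (β * d)
  have h3 := (hasDerivAt_id t).const_mul (β * d ^ (p - 1))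
  rw [show p - 1 - 1 = p - 2 by ring] at h2
  rw [mul_one] at h3
  exact (h1.add h2).sub h3

lemma continuous_burkholderProfile (hp : 1 < p) : Continuous (burkholderProfile p A β d) := by
  have h1 : Continuous fun t : ℝ => t ^ p := Real.continuous_rpow_const (by linarith)
  have h2 : Continuous fun t : ℝ => t ^ (p - 1) := Real.continuous_rpow_const (by linarith)
  unfold burkholderProfile
  fun_prop

lemma concaveOn_burkholderProfile (hp : 1 < p) (hA : 0 ≤ A) (hd : 0 ≤ d)
    (h : β * (p - 2) ≤ p * A) : ConcaveOn ℝ (Set.Ici d) (burkholderProfile p A β d) := by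
  refine concaveOn_of_hasDerivWithinAt2_nonpos (convex_Ici d)
    (continuous_burkholderProfile hp).continuousOn
    (f' := fun t => -A * (p * t ^ (p - 1)) + β * d * ((p - 1) * t ^ (p - 2)) - β * d ^ (p - 1))
    (f'' := fun t => -A * (p * ((p - 1) * t ^ (p - 2)))
      + β * d * ((p - 1) * ((p - 2) * t ^ (p - 3)))) ?_ ?_ ?_
  · intro t ht
    rw [interior_Ici] at ht
    exact (hasDerivAt_burkholderProfile (hd.trans_lt ht)).hasDerivWithinAt
  · intro t ht
    rw [interior_Ici] at ht
    have ht0 : t ≠ 0 := (hd.trans_lt ht).ne'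
    have h1 := (Real.hasDerivAt_rpow_const (x := t) (p := p - 1) (Or.inl ht0)).const_mul p
    have h2 := (Real.hasDerivAt_rpow_const (x := t) (p := p - 2) (Or.inl ht0)).const_mul (p - 1)
    rw [show p - 1 - 1 = p - 2 by ring] at h1
    rw [show p - 2 - 1 = p - 3 by ring] at h2
    exact (((h1.const_mul (-A)).add (h2.const_mul (β * d))).sub_const _).hasDerivWithinAt
  · intro t ht
    rw [interior_Ici] at ht
    have htd : d < t := ht
    have ht0 : 0 < t := hd.trans_lt ht
    have e : t ^ (p - 2) = t ^ (p - 3) * t := by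
      rw [← Real.rpow_add_one ht0.ne']; congr 1; ring
    have hq : 0 ≤ t ^ (p - 3) := Real.rpow_nonneg ht0.le _
    have key : 0 ≤ p * A * t - β * (p - 2) * d := by
      have := mul_le_mul_of_nonneg_right h hd
      have := mul_le_mul_of_nonneg_left htd.le (mul_nonneg (by linarith : 0 ≤ p) hA)
      linarith
    have := mul_nonneg (mul_nonneg (by linarith : 0 ≤ p - 1) hq) key
    simp only [e]
    linarith

lemma antitoneOn_burkholderProfile (hp : 1 < p) (hA : 0 ≤ A) (hd : 0 ≤ d)
    (h : β * (p - 2) ≤ p * A) : AntitoneOn (burkholderProfile p A β d) (Set.Ici d) := by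
  refine antitoneOn_of_deriv_nonpos (convex_Ici d)
    (continuous_burkholderProfile hp).continuousOn ?_ ?_
  · intro t ht
    rw [interior_Ici] at ht
    exact (hasDerivAt_burkholderProfile (hd.trans_lt ht)).differentiableAt.differentiableWithinAt
  · intro t ht
    rw [interior_Ici] at ht
    have htd : d < t := ht
    have ht0 : 0 < t := hd.trans_lt ht
    rw [(hasDerivAt_burkholderProfile ht0).deriv]
    obtain ⟨x, hx⟩ : ∃ x, x = d / t := ⟨_, rfl⟩
    have hx0 : 0 ≤ x := hx ▸ div_nonneg hd ht0.le
    have hx1 : x ≤ 1 := hx ▸ (div_le_one ht0).2 htd.le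
    have hdx : d = x * t := by rw [hx]; field_simp
    have e1 : t ^ (p - 1) = t ^ (p - 2) * t := by
      rw [← Real.rpow_add_one ht0.ne']; congr 1; ring
    have hq : 0 ≤ t ^ (p - 1) := Real.rpow_nonneg ht0.le _
    have e2 : d ^ (p - 1) = x ^ (p - 1) * t ^ (p - 1) := by
      rw [hdx, Real.mul_rpow hx0 ht0.le]
    have key : 0 ≤ p * A - β * (p - 1) * x + β * x ^ (p - 1) := by
      have hpA : 0 ≤ p * A := mul_nonneg (by linarith) hA
      rcases le_total 2 p with h2 | h2
      · have b1 : 1 + (p - 1) * (x - 1) ≤ x ^ (p - 1) := by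
          simpa using one_add_mul_self_le_rpow_one_add (s := x - 1) (by linarith)
            (p := p - 1) (by linarith)
        have b2 : x ^ (p - 1) ≤ x := by
          simpa using Real.rpow_le_rpow_of_exponent_ge_of_imp hx0 hx1
            (by linarith : (1 : ℝ) ≤ p - 1) (fun _ h => by linarith)
        rcases le_total 0 β with hβ | hβ
        · nlinarith
        · nlinarith [mul_nonneg (by linarith : 0 ≤ p - 2) hx0]
      · have b1 : x ^ (p - 1) ≤ 1 + (p - 1) * (x - 1) := by
          simpa using rpow_one_add_le_one_add_mul_self (s := x - 1) (by linarith)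
            (p := p - 1) (by linarith) (by linarith)
        have b2 : x ≤ x ^ (p - 1) := by
          simpa using Real.rpow_le_rpow_of_exponent_ge_of_imp hx0 hx1
            (by linarith : p - 1 ≤ (1 : ℝ)) (fun _ h => by linarith)
        rcases le_total 0 β with hβ | hβ
        · nlinarith [mul_nonneg (by linarith : 0 ≤ 2 - p) hx0]
        · nlinarith
    have e3 : d * t ^ (p - 2) = x * t ^ (p - 1) := by rw [e1, hdx]; ring
    have := mul_nonneg key hq
    rw [e2]
    linear_combination β * (p - 1) * e3 + this

lemma burkholderProfile_max_midpoint (hp : 1 < p) (hA : 0 ≤ A) (hd : 0 ≤ d)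
    (h : β * (p - 2) ≤ p * A) (t k : ℝ) :
    burkholderProfile p A β d (max (t + k) d) + burkholderProfile p A β d (max (t - k) d) ≤
      2 * burkholderProfile p A β d (max t d) := by
  have hc := (concaveOn_burkholderProfile hp hA hd h).2
    (Set.mem_Ici.2 (le_max_right (t + k) d)) (Set.mem_Ici.2 (le_max_right (t - k) d))
    (by norm_num : (0 : ℝ) ≤ 1 / 2) (by norm_num : (0 : ℝ) ≤ 1 / 2) (by norm_num)
  have hm : max t d ≤ 1 / 2 * max (t + k) d + 1 / 2 * max (t - k) d := by
    refine max_le ?_ ?_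
    · linarith [le_max_left (t + k) d, le_max_left (t - k) d]
    · linarith [le_max_right (t + k) d, le_max_right (t - k) d]
  have ha := antitoneOn_burkholderProfile hp hA hd h (Set.mem_Ici.2 (le_max_right t d))
    (Set.mem_Ici.2 ((le_max_right t d).trans hm)) hm
  simp only [smul_eq_mul] at hc
  linarith

end Profile

/-- Burkholder's function `(|x| + |y|)^(p-1) (|y| - c |x|)`. -/
noncomputable def burkholderFn (p c x y : ℝ) : ℝ :=
  (|x| + |y|) ^ (p - 1) * (|y| - c * |x|)

lemma burkholderFn_diag {p c d : ℝ} (hp : 1 < p) (hd : 0 ≤ d) (t : ℝ) :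
    burkholderFn p c (t + d) (t - d) = 2 ^ (p - 1) *
      (burkholderProfile p (c - 1) (-(1 + c)) d (max t d)
        + burkholderProfile p (c - 1) (1 + c) d (max (-t) d)
        + ((c - 1) * d ^ p - (1 + c) * d ^ (p - 1) * t)) := by
  have hpow : ∀ s : ℝ, 0 ≤ s → s ^ p = s ^ (p - 1) * s := fun s hs => by
    rw [← Real.rpow_add_one' hs (by linarith)]; congr 1; ring
  have hmul : ∀ s : ℝ, 0 ≤ s → (2 * s) ^ (p - 1) = 2 ^ (p - 1) * s ^ (p - 1) := fun s hs =>
    Real.mul_rpow (by norm_num) hs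
  unfold burkholderFn burkholderProfile
  rcases le_total d t with h1 | h1
  · have ht := hd.trans h1
    rw [abs_of_nonneg (by linarith), abs_of_nonneg (by linarith), max_eq_left h1,
      max_eq_right (by linarith), show t + d + (t - d) = 2 * t by ring, hmul t ht, hpow t ht,
      hpow d hd]
    ring
  · rcases le_total (-d) t with h2 | h2
    · rw [abs_of_nonneg (by linarith), abs_of_nonpos (by linarith), max_eq_right h1,
        max_eq_right (by linarith), show t + d + -(t - d) = 2 * d by ring, hmul d hd, hpow d hd]
      ring
    · rw [abs_of_nonpos (by linarith), abs_of_nonpos (by linarith), max_eq_right h1,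
        max_eq_left (by linarith), show -(t + d) + -(t - d) = 2 * -t by ring,
        hmul (-t) (by linarith), hpow (-t) (by linarith), hpow d hd]
      ring

lemma burkholderFn_midpoint_diag {p c : ℝ} (hp : 1 < p) (hc : p - 1 ≤ c) (hc' : 1 ≤ (p - 1) * c)
    (x y k : ℝ) :
    burkholderFn p c (x + k) (y + k) + burkholderFn p c (x - k) (y - k) ≤
      2 * burkholderFn p c x y := by
  have hc1 : 0 ≤ c - 1 := by nlinarith
  have main : ∀ d t k : ℝ, 0 ≤ d →
      burkholderFn p c (t + k + d) (t + k - d) + burkholderFn p c (t - k + d) (t - k - d) ≤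
        2 * burkholderFn p c (t + d) (t - d) := by
    intro d t k hd
    simp only [burkholderFn_diag hp hd]
    have h1 := burkholderProfile_max_midpoint hp hc1 hd
      (by linarith : -(1 + c) * (p - 2) ≤ p * (c - 1)) t k
    have h2 := burkholderProfile_max_midpoint hp hc1 hd
      (by linarith : (1 + c) * (p - 2) ≤ p * (c - 1)) (-t) k
    rw [show -t + k = -(t - k) by ring, show -t - k = -(t + k) by ring] at h2
    have h3 : (0 : ℝ) ≤ 2 ^ (p - 1) := by positivity
    have h4 := mul_le_mul_of_nonneg_left (add_le_add h1 h2) h3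
    linarith
  have hneg : ∀ x y : ℝ, burkholderFn p c (-x) (-y) = burkholderFn p c x y := by
    simp [burkholderFn]
  rcases le_total y x with h | h
  · have := main ((x - y) / 2) ((x + y) / 2) k (by linarith)
    ring_nf at this ⊢
    linarith
  · have := main ((y - x) / 2) (-(x + y) / 2) k (by linarith)
    rw [← hneg (x + k), ← hneg (x - k), ← hneg x]
    ring_nf at this ⊢
    linarith

lemma burkholderFn_midpoint {p c : ℝ} (hp : 1 < p) (hc : p - 1 ≤ c) (hc' : 1 ≤ (p - 1) * c)
    {e : ℝ} (he : e = 1 ∨ e = -1) (x y k : ℝ) :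
    burkholderFn p c (x + e * k) (y + k) + burkholderFn p c (x - e * k) (y - k) ≤
      2 * burkholderFn p c x y := by
  rcases he with rfl | rfl
  · simpa using burkholderFn_midpoint_diag hp hc hc' x y k
  · have hneg : ∀ x y : ℝ, burkholderFn p c (-x) y = burkholderFn p c x y := by
      simp [burkholderFn]
    have := burkholderFn_midpoint_diag hp hc hc' (-x) y k
    rw [← hneg (x + _), ← hneg (x - _), ← hneg x]
    convert this using 3 <;> ring

lemma abs_rpow_le_burkholderFn {p c : ℝ} (hp : 1 < p) (hc : 0 ≤ c) (x y : ℝ) :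
    |y| ^ p ≤ 2 * burkholderFn p c x y
      + ((2 * c) ^ p + 2 * c * (1 + 2 * c) ^ (p - 1)) * |x| ^ p := by
  have hx := abs_nonneg x
  have hy := abs_nonneg y
  have hpow : ∀ s : ℝ, 0 ≤ s → s ^ p = s ^ (p - 1) * s := fun s hs => by
    rw [← Real.rpow_add_one' hs (by linarith)]; congr 1; ring
  unfold burkholderFn
  generalize |x| = u at *
  generalize |y| = v at *
  have hu : 0 ≤ u ^ p := Real.rpow_nonneg hx p
  rcases le_total (2 * c * u) v with h | h
  · have h1 : v ^ (p - 1) ≤ (u + v) ^ (p - 1) :=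
      Real.rpow_le_rpow hy (by linarith) (by linarith)
    have h2 : v ^ (p - 1) * (v / 2) ≤ (u + v) ^ (p - 1) * (v - c * u) :=
      mul_le_mul h1 (by linarith) (by linarith) (Real.rpow_nonneg (by linarith) _)
    have h3 : 0 ≤ ((2 * c) ^ p + 2 * c * (1 + 2 * c) ^ (p - 1)) * u ^ p := by positivity
    rw [hpow v hy]
    linarith
  · have h1 : v ^ p ≤ (2 * c) ^ p * u ^ p := by
      rw [← Real.mul_rpow (by linarith) hx]
      exact Real.rpow_le_rpow hy h (by linarith)
    have h2 : (u + v) ^ (p - 1) ≤ (1 + 2 * c) ^ (p - 1) * u ^ (p - 1) := by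
      rw [← Real.mul_rpow (by linarith) hx]
      exact Real.rpow_le_rpow (by linarith) (by linarith) (by linarith)
    have h3 := mul_le_mul_of_nonneg_right h2 (mul_nonneg hc hx)
    have h4 : 0 ≤ (u + v) ^ (p - 1) * v := by positivity
    have h5 : (1 + 2 * c) ^ (p - 1) * u ^ p = (1 + 2 * c) ^ (p - 1) * u ^ (p - 1) * u := by
      rw [hpow u hx]; ring
    linear_combination h1 + 2 * h3 + 2 * h4 - 2 * c * h5

lemma continuous_burkholderFn {p : ℝ} (hp : 1 < p) (c : ℝ) :
    Continuous fun z : ℝ × ℝ => burkholderFn p c z.1 z.2 := by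
  unfold burkholderFn
  refine Continuous.mul ?_ (by fun_prop)
  exact (Real.continuous_rpow_const (by linarith : 0 ≤ p - 1)).comp
    (by fun_prop : Continuous fun z : ℝ × ℝ => |z.1| + |z.2|)

lemma burkholderFn_nonpos {p c : ℝ} (hc : 1 ≤ c) {x y : ℝ} (h : |y| = |x|) :
    burkholderFn p c x y ≤ 0 := by
  unfold burkholderFn
  rw [h]
  refine mul_nonpos_of_nonneg_of_nonpos (by positivity) ?_
  nlinarith [abs_nonneg x]

section Haar

lemma measurable_haarFn (n i : ℕ) : Measurable (haarFn n i) := by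
  unfold haarFn
  exact Measurable.ite measurableSet_Ioo measurable_const
    (Measurable.ite measurableSet_Ioo measurable_const measurable_const)

lemma abs_haarFn_le_one (n i : ℕ) (t : ℝ) : |haarFn n i t| ≤ 1 := by
  unfold haarFn
  split_ifs <;> simp

/-- Left endpoint of the support of `haarFn n i`. -/
noncomputable def haarLeft (n i : ℕ) : ℝ := (2 * (i : ℝ) - 2) / 2 ^ (n + 1)

/-- Right endpoint of the support of `haarFn n i`. -/
noncomputable def haarRight (n i : ℕ) : ℝ := 2 * (i : ℝ) / 2 ^ (n + 1)

lemma haarLeft_lt_haarRight (n i : ℕ) : haarLeft n i < haarRight n i := by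
  unfold haarLeft haarRight
  gcongr
  linarith

lemma haarFn_eq_zero {n i : ℕ} {t : ℝ} (ht : t ∉ Set.Ioo (haarLeft n i) (haarRight n i)) :
    haarFn n i t = 0 := by
  have h1 : (2 * (i : ℝ) - 2) / 2 ^ (n + 1) < (2 * (i : ℝ) - 1) / 2 ^ (n + 1) := by
    gcongr; norm_num
  have h2 : (2 * (i : ℝ) - 1) / 2 ^ (n + 1) < 2 * (i : ℝ) / 2 ^ (n + 1) := by
    gcongr; linarith
  unfold haarLeft haarRight at ht
  unfold haarFn
  rw [if_neg fun h => ht ⟨h.1, h.2.trans h2⟩, if_neg fun h => ht ⟨h1.trans h.1, h.2⟩]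

lemma haarFn_reflect_self (n i : ℕ) (t : ℝ) :
    haarFn n i (haarLeft n i + haarRight n i - t) = -haarFn n i t := by
  have h1 : (2 * (i : ℝ) - 2) / 2 ^ (n + 1) + 2 * (i : ℝ) / 2 ^ (n + 1) =
      2 * ((2 * (i : ℝ) - 1) / 2 ^ (n + 1)) := by ring
  unfold haarFn haarLeft haarRight
  simp only [Set.mem_Ioo]
  generalize (2 * (i : ℝ) - 2) / 2 ^ (n + 1) = a at *
  generalize (2 * (i : ℝ) - 1) / 2 ^ (n + 1) = b at *
  generalize 2 * (i : ℝ) / 2 ^ (n + 1) = c at *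
  split_ifs <;> first | (norm_num; done) | (exfalso; grind)

/-- A dyadic point of a coarser level does not separate two points of a dyadic interval. -/
lemma dyadic_lt_of_lt {m n : ℕ} (hmn : m < n) (k z : ℤ) {t t' : ℝ}
    (ht : t < (k + 1) / 2 ^ n) (ht' : k / 2 ^ n < t') (h : (z : ℝ) / 2 ^ (m + 1) < t) :
    (z : ℝ) / 2 ^ (m + 1) < t' := by
  obtain ⟨r, rfl⟩ := Nat.exists_eq_add_of_le (Nat.succ_le_of_lt hmn)
  have e : (z : ℝ) / 2 ^ (m + 1) = ((z * 2 ^ r : ℤ) : ℝ) / 2 ^ (m.succ + r) := by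
    push_cast
    rw [Nat.succ_eq_add_one, pow_add _ (m + 1) r]
    field_simp
  rw [e] at h ⊢
  have h1 := (div_lt_div_iff_of_pos_right (by positivity)).1 (h.trans ht)
  have h2 : z * 2 ^ r ≤ k := Int.lt_add_one_iff.1 (by exact_mod_cast h1)
  refine lt_of_le_of_lt ?_ ht'
  gcongr

lemma haarFn_congr_of_mem {m n i j : ℕ} (hmn : m < n) {t t' : ℝ}
    (ht : t ∈ Set.Ioo (haarLeft n i) (haarRight n i))
    (ht' : t' ∈ Set.Ioo (haarLeft n i) (haarRight n i)) : haarFn m j t = haarFn m j t' := by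
  have eL : haarLeft n i = (((i : ℤ) - 1 : ℤ) : ℝ) / 2 ^ n := by
    unfold haarLeft; push_cast; rw [pow_succ]; field_simp
  have eR : haarRight n i = ((((i : ℤ) - 1 : ℤ) : ℝ) + 1) / 2 ^ n := by
    unfold haarRight; push_cast; rw [pow_succ]; field_simp; ring
  have eL' : -haarLeft n i = ((-(i : ℤ) : ℤ) + 1 : ℝ) / 2 ^ n := by
    rw [eL]; push_cast; ring
  have eR' : -haarRight n i = ((-(i : ℤ) : ℤ) : ℝ) / 2 ^ n := by
    rw [eR]; push_cast; ring
  have hlt : ∀ (z : ℤ) {t t' : ℝ}, t ∈ Set.Ioo (haarLeft n i) (haarRight n i) →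
      t' ∈ Set.Ioo (haarLeft n i) (haarRight n i) →
      (z : ℝ) / 2 ^ (m + 1) < t → (z : ℝ) / 2 ^ (m + 1) < t' := fun z t t' h h' =>
    dyadic_lt_of_lt hmn _ z (eR ▸ h.2) (eL ▸ h'.1)
  have hgt : ∀ (z : ℤ) {t t' : ℝ}, t ∈ Set.Ioo (haarLeft n i) (haarRight n i) →
      t' ∈ Set.Ioo (haarLeft n i) (haarRight n i) →
      t < (z : ℝ) / 2 ^ (m + 1) → t' < (z : ℝ) / 2 ^ (m + 1) := by
    intro z t t' h h' hz
    have := dyadic_lt_of_lt hmn (-(i : ℤ)) (-z) (t := -t) (t' := -t')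
      (eL' ▸ neg_lt_neg h.1) (eR' ▸ neg_lt_neg h'.2)
      (by push_cast; rw [neg_div]; exact neg_lt_neg hz)
    push_cast at this
    rw [neg_div] at this
    exact neg_lt_neg_iff.1 this
  have hmem : ∀ z w : ℤ, t ∈ Set.Ioo ((z : ℝ) / 2 ^ (m + 1)) ((w : ℝ) / 2 ^ (m + 1)) ↔
      t' ∈ Set.Ioo ((z : ℝ) / 2 ^ (m + 1)) ((w : ℝ) / 2 ^ (m + 1)) := fun z w =>
    ⟨fun h => ⟨hlt z ht ht' h.1, hgt w ht ht' h.2⟩, fun h => ⟨hlt z ht' ht h.1, hgt w ht' ht h.2⟩⟩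
  have h1 := hmem (2 * j - 2) (2 * j - 1)
  have h2 := hmem (2 * j - 1) (2 * j)
  push_cast at h1 h2
  unfold haarFn
  simp only [h1, h2]

lemma haarFn_eq_zero_of_ne {n i j : ℕ} (hij : j ≠ i) {t : ℝ}
    (ht : t ∈ Set.Ioo (haarLeft n i) (haarRight n i)) : haarFn n j t = 0 := by
  refine haarFn_eq_zero fun h => ?_
  have h1 := ht.1.trans h.2
  have h2 := h.1.trans ht.2
  unfold haarLeft haarRight at h1 h2
  rw [div_lt_div_iff_of_pos_right (by positivity)] at h1 h2
  have h3 : (i : ℝ) < j + 1 := by linarith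
  have h4 : (j : ℝ) < i + 1 := by linarith
  norm_cast at h3 h4
  omega

lemma haarFn_reflect {q r : ℕ × ℕ} (hqr : r ≠ q) (hr : r.1 ≤ q.1) {t : ℝ}
    (ht : t ∈ Set.Ioo (haarLeft q.1 q.2) (haarRight q.1 q.2)) :
    haarFn r.1 r.2 (haarLeft q.1 q.2 + haarRight q.1 q.2 - t) = haarFn r.1 r.2 t := by
  have ht' : haarLeft q.1 q.2 + haarRight q.1 q.2 - t ∈
      Set.Ioo (haarLeft q.1 q.2) (haarRight q.1 q.2) :=
    ⟨by linarith [ht.2], by linarith [ht.1]⟩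
  rcases hr.lt_or_eq with h | h
  · exact haarFn_congr_of_mem h ht' ht
  · have hne : r.2 ≠ q.2 := fun h' => hqr (Prod.ext h h')
    rw [h, haarFn_eq_zero_of_ne hne ht, haarFn_eq_zero_of_ne hne ht']

/-- The index `(n, i)` either has its support inside `[0, 1]`, or `haarFn n i` vanishes there. -/
lemma haarFn_support_cases (n i : ℕ) :
    (0 ≤ haarLeft n i ∧ haarRight n i ≤ 1) ∨ ∀ t ∈ Set.Icc (0 : ℝ) 1, haarFn n i t = 0 := by
  have h2 : (0 : ℝ) < 2 ^ (n + 1) := by positivity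
  have hp : (2 : ℝ) ^ (n + 1) = 2 * 2 ^ n := by ring
  rcases Nat.eq_zero_or_pos i with rfl | hi
  · refine Or.inr fun t ht => haarFn_eq_zero fun h => ?_
    have := h.2
    simp only [haarRight, Nat.cast_zero, mul_zero, zero_div] at this
    linarith [ht.1]
  · have hi' : (1 : ℝ) ≤ i := by exact_mod_cast hi
    rcases le_or_gt i (2 ^ n) with h | h
    · have h' : (i : ℝ) ≤ 2 ^ n := by exact_mod_cast h
      refine Or.inl ⟨div_nonneg (by linarith) h2.le, (div_le_one h2).2 (by linarith)⟩
    · have h' : (2 : ℝ) ^ n + 1 ≤ i := by exact_mod_cast h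
      refine Or.inr fun t ht => haarFn_eq_zero fun h => ?_
      have : 1 ≤ haarLeft n i := (one_le_div h2).2 (by linarith)
      linarith [ht.2, h.1]

/-- Continuous functions of finite Haar sums are integrable on bounded intervals. -/
lemma intervalIntegrable_haar_sum {Φ : ℝ × ℝ → ℝ} (hΦ : Continuous Φ) (s : Finset (ℕ × ℕ))
    (u v : ℕ × ℕ → ℝ) (x y a b : ℝ) :
    IntervalIntegrable (fun t => Φ (x + ∑ q ∈ s, u q * haarFn q.1 q.2 t,
      y + ∑ q ∈ s, v q * haarFn q.1 q.2 t)) volume a b := by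
  have hm : ∀ (w : ℕ × ℕ → ℝ) (z : ℝ), Measurable fun t => z + ∑ q ∈ s, w q * haarFn q.1 q.2 t :=
    fun w z => (Finset.measurable_sum s fun q _ =>
      (measurable_haarFn q.1 q.2).const_mul (w q)).const_add z
  have hb : ∀ (w : ℕ × ℕ → ℝ) (z t : ℝ), z + ∑ q ∈ s, w q * haarFn q.1 q.2 t ∈
      Metric.closedBall z (∑ q ∈ s, |w q|) := by
    intro w z t
    rw [Metric.mem_closedBall, Real.dist_eq, add_sub_cancel_left]
    refine (Finset.abs_sum_le_sum_abs _ _).trans (Finset.sum_le_sum fun q _ => ?_)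
    rw [abs_mul]
    exact mul_le_of_le_one_right (abs_nonneg _) (abs_haarFn_le_one _ _ _)
  obtain ⟨C, hC⟩ := ((isCompact_closedBall x (∑ q ∈ s, |u q|)).prod
    (isCompact_closedBall y (∑ q ∈ s, |v q|))).exists_bound_of_continuousOn hΦ.continuousOn
  rw [intervalIntegrable_iff]
  refine Measure.integrableOn_of_bounded (M := C) (by simp)
    (hΦ.measurable.comp ((hm u x).prodMk (hm v y))).aestronglyMeasurable ?_
  exact Filter.Eventually.of_forall fun t => hC _ ⟨hb u x t, hb v y t⟩

lemma integral_nonpos_of_reflect {D : ℝ → ℝ} {a b : ℝ} (hab : a ≤ b)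
    (hD : IntervalIntegrable D volume a b)
    (h : ∀ t ∈ Set.Ioo a b, D t + D (a + b - t) ≤ 0) : ∫ t in a..b, D t ≤ 0 := by
  have h1 : ∫ t in a..b, D (a + b - t) = ∫ t in a..b, D t := by
    rw [intervalIntegral.integral_comp_sub_left]; simp
  have hD' : IntervalIntegrable (fun t => D (a + b - t)) volume a b := by
    have := (hD.comp_sub_left (a + b)).symm
    simpa using this
  have h2 : ∫ t in a..b, (D t + D (a + b - t)) ≤ ∫ _ in a..b, (0 : ℝ) :=
    intervalIntegral.integral_mono_on_of_le_Ioo hab (hD.add hD') (by simp) h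
  rw [intervalIntegral.integral_add hD hD', h1] at h2
  simp only [intervalIntegral.integral_zero] at h2
  linarith

theorem integral_burkholderFn_haar_le {p c : ℝ} (hp : 1 < p) (hc : p - 1 ≤ c)
    (hc' : 1 ≤ (p - 1) * c) (a ε : ℕ × ℕ → ℝ) (hε : ∀ q, ε q = 1 ∨ ε q = -1) (x y : ℝ)
    (s : Finset (ℕ × ℕ)) :
    ∫ t in (0 : ℝ)..1, burkholderFn p c (x + ∑ q ∈ s, ε q * a q * haarFn q.1 q.2 t)
      (y + ∑ q ∈ s, a q * haarFn q.1 q.2 t) ≤ burkholderFn p c x y := by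
  induction s using Finset.induction_on_max_value (f := (Prod.fst : ℕ × ℕ → ℕ)) with
  | empty => simp
  | insert q s hq hmax ih =>
    refine le_trans ?_ ih
    have hint : ∀ (s : Finset (ℕ × ℕ)) (α β : ℝ), IntervalIntegrable
        (fun t => burkholderFn p c (x + ∑ q ∈ s, ε q * a q * haarFn q.1 q.2 t)
          (y + ∑ q ∈ s, a q * haarFn q.1 q.2 t)) volume α β := fun s α β =>
      intervalIntegrable_haar_sum (continuous_burkholderFn hp c) s (fun q => ε q * a q) a x y α β
    have hI := hint (insert q s)
    simp only [Finset.sum_insert hq] at hI ⊢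
    have hJ := hint s
    rw [← sub_nonpos, ← intervalIntegral.integral_sub (hI 0 1) (hJ 0 1)]
    have hDint := fun α β => (hI α β).sub (hJ α β)
    obtain ⟨D, hD⟩ : ∃ D : ℝ → ℝ, D = fun t =>
      burkholderFn p c (x + (ε q * a q * haarFn q.1 q.2 t + ∑ q ∈ s, ε q * a q * haarFn q.1 q.2 t))
          (y + (a q * haarFn q.1 q.2 t + ∑ q ∈ s, a q * haarFn q.1 q.2 t))
        - burkholderFn p c (x + ∑ q ∈ s, ε q * a q * haarFn q.1 q.2 t)
          (y + ∑ q ∈ s, a q * haarFn q.1 q.2 t) := ⟨_, rfl⟩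
    have hD0 : ∀ t, haarFn q.1 q.2 t = 0 → D t = 0 := by
      intro t ht
      simp [hD, ht]
    change ∀ α β, IntervalIntegrable (fun t => _) volume α β at hDint
    rw [← hD] at hDint
    rw [← hD]
    rcases haarFn_support_cases q.1 q.2 with ⟨hl, hr⟩ | hz
    · have hlr := haarLeft_lt_haarRight q.1 q.2
      have hleft : ∫ t in (0 : ℝ)..haarLeft q.1 q.2, D t = 0 := by
        refine intervalIntegral.integral_zero_ae (Filter.Eventually.of_forall fun t ht => ?_)
        rw [Set.uIoc_of_le hl] at ht
        exact hD0 t (haarFn_eq_zero fun h => by linarith [ht.2, h.1])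
      have hright : ∫ t in haarRight q.1 q.2..1, D t = 0 := by
        refine intervalIntegral.integral_zero_ae (Filter.Eventually.of_forall fun t ht => ?_)
        rw [Set.uIoc_of_le hr] at ht
        exact hD0 t (haarFn_eq_zero fun h => by linarith [ht.1, h.2])
      rw [← intervalIntegral.integral_add_adjacent_intervals (hDint 0 (haarLeft q.1 q.2))
        (hDint _ 1), ← intervalIntegral.integral_add_adjacent_intervals
        (hDint (haarLeft q.1 q.2) (haarRight q.1 q.2)) (hDint _ 1), hleft, hright, zero_add,
        add_zero]
      refine integral_nonpos_of_reflect hlr.le (hDint _ _) fun t ht => ?_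
      have hsum : ∀ w : ℕ × ℕ → ℝ,
          ∑ r ∈ s, w r * haarFn r.1 r.2 (haarLeft q.1 q.2 + haarRight q.1 q.2 - t) =
            ∑ r ∈ s, w r * haarFn r.1 r.2 t := fun w =>
        Finset.sum_congr rfl fun r hr => by
          rw [haarFn_reflect (ne_of_mem_of_not_mem hr hq) (hmax r hr) ht]
      have key := burkholderFn_midpoint hp hc hc' (hε q)
        (x + ∑ q ∈ s, ε q * a q * haarFn q.1 q.2 t) (y + ∑ q ∈ s, a q * haarFn q.1 q.2 t)
        (a q * haarFn q.1 q.2 t)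
      simp only [hD, hsum a, hsum fun q => ε q * a q, haarFn_reflect_self]
      ring_nf at key ⊢
      linarith
    · refine le_of_eq (intervalIntegral.integral_zero_ae (Filter.Eventually.of_forall ?_))
      intro t ht
      rw [Set.uIoc_of_le zero_le_one] at ht
      exact hD0 t (hz t ⟨ht.1.le, ht.2⟩)

/-- A finite sum over the Haar system is a constant plus a sum of functions `haarFn`. -/
lemma exists_haarSystem_sum_eq (s : Finset (ℕ × ℕ)) :
    ∃ δ : ℝ, ∀ (w : ℕ × ℕ → ℝ) (t : ℝ), ∑ q ∈ s, w q * haarSystem q t =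
      δ * w (0, 0) + ∑ q ∈ s.erase (0, 0), w q * haarFn q.1 q.2 t := by
  have h : ∀ (w : ℕ × ℕ → ℝ) (t : ℝ), ∑ q ∈ s.erase (0, 0), w q * haarSystem q t =
      ∑ q ∈ s.erase (0, 0), w q * haarFn q.1 q.2 t := fun w t =>
    Finset.sum_congr rfl fun q hq => by rw [haarSystem, if_neg (Finset.ne_of_mem_erase hq)]
  by_cases h0 : (0, 0) ∈ s
  · refine ⟨1, fun w t => ?_⟩
    rw [← Finset.add_sum_erase s _ h0, h]
    simp [haarSystem]
  · refine ⟨0, fun w t => ?_⟩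
    rw [← h, Finset.erase_eq_of_notMem h0]
    simp

end Haar

/-- The Haar system is unconditional in `L_p[0,1]` for `1 < p < ∞`. -/
theorem haar_unconditional (p : ℝ) (hp : 1 < p) :
    ∃ H : ℝ, 0 < H ∧
      ∀ (s : Finset (ℕ × ℕ)) (a ε : ℕ × ℕ → ℝ),
        (∀ q, ε q = 1 ∨ ε q = -1) →
        eLpNorm (fun t => ∑ q ∈ s, a q * haarSystem q t) (ENNReal.ofReal p)
            (volume.restrict (Set.Icc (0 : ℝ) 1)) ≤
          ENNReal.ofReal H *
            eLpNorm (fun t => ∑ q ∈ s, ε q * a q * haarSystem q t) (ENNReal.ofReal p)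
              (volume.restrict (Set.Icc (0 : ℝ) 1)) := by
  have hp0 : 0 < p := by linarith
  obtain ⟨c, hc, hc'⟩ : ∃ c : ℝ, p - 1 ≤ c ∧ 1 ≤ (p - 1) * c := by
    refine ⟨max (p - 1) (1 / (p - 1)), le_max_left _ _, ?_⟩
    have h : (p - 1) * (1 / (p - 1)) = 1 := mul_one_div_cancel (by linarith)
    exact h.ge.trans (mul_le_mul_of_nonneg_left (le_max_right _ _) (by linarith))
  have hc1 : 1 ≤ c := by nlinarith
  obtain ⟨C, hC⟩ : ∃ C, C = (2 * c) ^ p + 2 * c * (1 + 2 * c) ^ (p - 1) := ⟨_, rfl⟩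
  have hC0 : 0 < C := by rw [hC]; positivity
  refine ⟨C ^ p⁻¹, by positivity, fun s a ε hε => ?_⟩
  obtain ⟨δ, hδ⟩ := exists_haarSystem_sum_eq s
  have hsum : ∀ (w : ℕ × ℕ → ℝ), (fun t => ∑ q ∈ s, w q * haarSystem q t) = fun t =>
      δ * w (0, 0) + ∑ q ∈ s.erase (0, 0), w q * haarFn q.1 q.2 t := fun w => funext (hδ w)
  rw [hsum a, hsum fun q => ε q * a q]
  have hcont : Continuous fun z : ℝ × ℝ => |z.1| ^ p :=
    (Real.continuous_rpow_const hp0.le).comp (by fun_prop : Continuous fun z : ℝ × ℝ => |z.1|)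
  have hLp : ∀ w : ℕ × ℕ → ℝ,
      eLpNorm (fun t => δ * w (0, 0) + ∑ q ∈ s.erase (0, 0), w q * haarFn q.1 q.2 t)
        (ENNReal.ofReal p) (volume.restrict (Set.Icc (0 : ℝ) 1)) =
      ENNReal.ofReal ((∫ t in (0 : ℝ)..1,
        |δ * w (0, 0) + ∑ q ∈ s.erase (0, 0), w q * haarFn q.1 q.2 t| ^ p) ^ p⁻¹) := by
    intro w
    have hm : Measurable fun t =>
        δ * w (0, 0) + ∑ q ∈ s.erase (0, 0), w q * haarFn q.1 q.2 t :=
      (Finset.measurable_sum _ fun q _ =>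
        (measurable_haarFn q.1 q.2).const_mul (w q)).const_add _
    have hi := intervalIntegrable_haar_sum hcont (s.erase (0, 0)) w w (δ * w (0, 0)) 0 0 1
    rw [intervalIntegrable_iff_integrableOn_Icc_of_le zero_le_one] at hi
    have hmem : MemLp (fun t => δ * w (0, 0) + ∑ q ∈ s.erase (0, 0), w q * haarFn q.1 q.2 t)
        (ENNReal.ofReal p) (volume.restrict (Set.Icc (0 : ℝ) 1)) := by
      rw [← integrable_norm_rpow_iff hm.aestronglyMeasurable (by simpa using hp0)
        ENNReal.ofReal_ne_top, ENNReal.toReal_ofReal hp0.le]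
      exact hi
    rw [hmem.eLpNorm_eq_integral_rpow_norm (by simpa using hp0) ENNReal.ofReal_ne_top,
      ENNReal.toReal_ofReal hp0.le, intervalIntegral.integral_of_le zero_le_one,
      integral_Icc_eq_integral_Ioc]
    rfl
  rw [hLp a, hLp fun q => ε q * a q, ← ENNReal.ofReal_mul (by positivity)]
  have hnn : ∀ f : ℝ → ℝ, 0 ≤ ∫ t in (0 : ℝ)..1, |f t| ^ p := fun f =>
    intervalIntegral.integral_nonneg zero_le_one fun t _ => by positivity
  refine ENNReal.ofReal_le_ofReal ?_
  rw [← Real.mul_rpow hC0.le (hnn _)]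
  refine Real.rpow_le_rpow (hnn _) ?_ (by positivity)
  have hU := integral_burkholderFn_haar_le hp hc hc' a ε hε (δ * (ε (0, 0) * a (0, 0)))
    (δ * a (0, 0)) (s.erase (0, 0))
  have hU0 : burkholderFn p c (δ * (ε (0, 0) * a (0, 0))) (δ * a (0, 0)) ≤ 0 := by
    refine burkholderFn_nonpos hc1 ?_
    rcases hε (0, 0) with h | h <;> simp [h, abs_mul]
  have hi1 := intervalIntegrable_haar_sum (continuous_burkholderFn hp c) (s.erase (0, 0))
    (fun q => ε q * a q) a (δ * (ε (0, 0) * a (0, 0))) (δ * a (0, 0)) 0 1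
  have hi2 := intervalIntegrable_haar_sum hcont (s.erase (0, 0))
    (fun q => ε q * a q) a (δ * (ε (0, 0) * a (0, 0))) (δ * a (0, 0)) 0 1
  have hi3 := intervalIntegrable_haar_sum hcont (s.erase (0, 0)) a a (δ * a (0, 0)) 0 0 1
  have hmono := intervalIntegral.integral_mono_on zero_le_one hi3
    ((hi1.const_mul 2).add (hi2.const_mul C)) fun t _ => by
      rw [hC]
      exact abs_rpow_le_burkholderFn hp (by linarith) _ _
  rw [intervalIntegral.integral_add (hi1.const_mul 2) (hi2.const_mul C),
    intervalIntegral.integral_const_mul, intervalIntegral.integral_const_mul] at hmono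
  linarith
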